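/- Let P : X × E → F be a map between complex Banach spaces which is C-linear in the second variable and, for each fixed v ∈ E, a continuous n-homogeneous polynomial in the first variable. If for every x ∈ X and every sequence of unit vectors v_i ∈ E and every continuous linear functional λ on X, the homogeneous components Q_j(x) = Σ_{n=0}^{j} P_n(x, v_{j−n}) λ(x)^{j−n} arising from a convergent germ remain bounded appropriately, one concludes: for every x ∈ X the linear map v ↦ P(x,v) is continuous. More precisely (as a self-contained statement): if φ : O^E_0 → O^F_0 is an O_0-module homomorphism of germ modules at 0 in a Banach space X with dim X > 0, then there is a germ Φ ∈ O^{Hom(E,F)}_0 such that φ(ṽ) = Φ·v for every constant germ ṽ with value v ∈ E. -/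

import Mathlib

open Filter Topology

/-- The value at `a` of a germ at `a` (well defined since every neighborhood contains `a`). -/
noncomputable def germValue {α β : Type*} [TopologicalSpace α] (a : α) :
    Filter.Germ (𝓝 a) β → β :=
  fun g => g.liftOn (fun f => f a) (fun _ _ h => h.self_of_nhds)

variable (X : Type*) [NormedAddCommGroup X] [NormedSpace ℂ X]

/-- The local ring `O_ζ` of scalar holomorphic germs at `ζ`. -/
noncomputable def Oat (ζ : X) : Subring (Filter.Germ (𝓝 ζ) ℂ) where
  carrier := {g | ∃ f : X → ℂ, AnalyticAt ℂ f ζ ∧ g = ↑f}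
  mul_mem' := by
    rintro a b ⟨f, hf, rfl⟩ ⟨k, hk, rfl⟩
    exact ⟨f * k, hf.mul hk, rfl⟩
  one_mem' := ⟨fun _ => 1, analyticAt_const, rfl⟩
  add_mem' := by
    rintro a b ⟨f, hf, rfl⟩ ⟨k, hk, rfl⟩
    exact ⟨f + k, hf.add hk, rfl⟩
  zero_mem' := ⟨fun _ => 0, analyticAt_const, rfl⟩
  neg_mem' := by
    rintro a ⟨f, hf, rfl⟩
    exact ⟨-f, hf.neg, rfl⟩

noncomputable instance (ζ : X) (M : Type*) [AddCommGroup M]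
    [Module (Filter.Germ (𝓝 ζ) ℂ) M] : Module (Oat X ζ) M :=
  Module.compHom M (Oat X ζ).subtype

variable (E : Type*) [NormedAddCommGroup E] [NormedSpace ℂ E]

/-- The `O_ζ`-module `O^E_ζ` of `E`-valued holomorphic germs at `ζ` (a "plain module"). -/
noncomputable def OEat (ζ : X) : Submodule (Oat X ζ) (Filter.Germ (𝓝 ζ) E) where
  carrier := {g | ∃ f : X → E, AnalyticAt ℂ f ζ ∧ g = ↑f}
  add_mem' := by
    rintro a b ⟨f, hf, rfl⟩ ⟨k, hk, rfl⟩
    exact ⟨f + k, hf.add hk, rfl⟩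
  zero_mem' := ⟨fun _ => 0, analyticAt_const, rfl⟩
  smul_mem' := by
    rintro ⟨c, a, ha, rfl⟩ x ⟨f, hf, rfl⟩
    exact ⟨fun z => a z • f z, ha.smul hf, rfl⟩

/-- The germ at `ζ` of a function analytic at `ζ`, as an element of `O^E_ζ`. -/
noncomputable def germOf (ζ : X) (f : X → E) (hf : AnalyticAt ℂ f ζ) : OEat X E ζ :=
  ⟨(↑f : Filter.Germ (𝓝 ζ) E), f, hf, rfl⟩

/-- The constant germ at `ζ` with value `v`. -/
noncomputable def constGerm (ζ : X) (v : E) : OEat X E ζ :=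
  germOf X E ζ (fun _ => v) analyticAt_const

/-- Evaluation at `ζ` as a ring homomorphism `O_ζ → ℂ`. -/
noncomputable def evalAt (ζ : X) : Oat X ζ →+* ℂ where
  toFun g := germValue ζ (g : Filter.Germ (𝓝 ζ) ℂ)
  map_one' := rfl
  map_mul' := by
    rintro ⟨a, _⟩ ⟨b, _⟩
    induction a using Filter.Germ.inductionOn
    induction b using Filter.Germ.inductionOn
    rfl
  map_zero' := rfl
  map_add' := by
    rintro ⟨a, _⟩ ⟨b, _⟩
    induction a using Filter.Germ.inductionOn
    induction b using Filter.Germ.inductionOn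
    rfl

/-- The maximal ideal `m_ζ ⊂ O_ζ` of germs vanishing at `ζ`. -/
noncomputable def mIdeal (ζ : X) : Ideal (Oat X ζ) := RingHom.ker (evalAt X ζ)

/-- Positivity of the `I`-depth of a module `M`: either `M = IM` (depth `+∞` by convention),
or there is a nonzerodivisor `r ∈ I` on `M` with `rM ≠ M`. -/
def IsDepthPos (R : Type*) [CommRing R] (I : Ideal R) (M : Type*) [AddCommGroup M]
    [Module R M] : Prop :=
  (I • (⊤ : Submodule R M) = ⊤) ∨
    ∃ r ∈ I, (∀ x : M, r • x = 0 → x = 0) ∧ Ideal.span {r} • (⊤ : Submodule R M) ≠ ⊤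

section Coefficients

variable {E F : Type*} [NormedAddCommGroup E] [NormedSpace ℂ E]
  [NormedAddCommGroup F] [NormedSpace ℂ F]

/-- A linear map into a normed space that is not bounded takes, on the unit ball, values
arbitrarily far from any given point. -/
theorem LinearMap.exists_le_norm_add_of_not_bounded (g : E →ₗ[ℂ] F)
    (hg : ¬ ∃ M : ℝ, ∀ v, ‖v‖ ≤ 1 → ‖g v‖ ≤ M) (w : F) (R : ℝ) :
    ∃ v, ‖v‖ ≤ 1 ∧ R ≤ ‖g v + w‖ := by
  push Not at hg
  obtain ⟨v, hv, hlt⟩ := hg (R + ‖w‖)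
  refine ⟨v, hv, ?_⟩
  have := norm_sub_le (g v + w) w
  rw [add_sub_cancel_right] at this
  linarith

/-- Gliding hump: if all the convolutions `∑ i ≤ j, c (j - i) (v i)` with sequences `v` in the
unit ball grow at most geometrically in `j`, then every `c n` is bounded on the unit ball. -/
theorem LinearMap.bounded_of_convolution_growth (c : ℕ → E →ₗ[ℂ] F)
    (hc : ∀ v : ℕ → E, (∀ i, ‖v i‖ ≤ 1) → ∃ K : ℝ, 0 ≤ K ∧
      ∀ j, ‖∑ i ∈ Finset.range (j + 1), c (j - i) (v i)‖ ≤ K ^ (j + 1)) (n : ℕ) :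
    ∃ M : ℝ, ∀ v, ‖v‖ ≤ 1 → ‖c n v‖ ≤ M := by
  induction n using Nat.strong_induction_on with
  | _ n ih =>
  by_contra hn
  choose! M hM using ih
  choose pick pick_norm pick_le using (c n).exists_le_norm_add_of_not_bounded hn
  let S : ℝ := ∑ m ∈ Finset.range n, M m
  let step : (i : ℕ) → ((k : ℕ) → k < i → E) → E := fun i prev =>
    pick (∑ k : Fin i, c (n + i - k) (prev k k.2)) (S + ((i : ℝ) + 1) ^ (n + i + 1))
  let v : ℕ → E := WellFounded.fix Nat.lt_wfRel.wf step
  have v_eq (i : ℕ) : v i = pick (∑ k ∈ Finset.range i, c (n + i - k) (v k))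
      (S + ((i : ℝ) + 1) ^ (n + i + 1)) := by
    rw [Finset.sum_range]
    exact WellFounded.fix_eq _ step i
  have v_norm (i : ℕ) : ‖v i‖ ≤ 1 := by rw [v_eq]; exact pick_norm _ _
  obtain ⟨K, hK0, hK⟩ := hc v v_norm
  have key (i : ℕ) : ((i : ℝ) + 1) ^ (n + i + 1) ≤ K ^ (n + i + 1) := by
    have hle := pick_le (∑ k ∈ Finset.range i, c (n + i - k) (v k))
      (S + ((i : ℝ) + 1) ^ (n + i + 1))
    rw [← v_eq] at hle
    have htail : ‖∑ k ∈ Finset.range n, c (n + i - (i + 1 + k)) (v (i + 1 + k))‖ ≤ S := by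
      refine (norm_sum_le _ _).trans ?_
      rw [← Finset.sum_range_reflect]
      refine Finset.sum_le_sum fun m hm => ?_
      rw [Finset.mem_range] at hm
      have : n + i - (i + 1 + (n - 1 - m)) = m := by omega
      rw [this]
      exact hM m hm _ (v_norm _)
    have hsplit := hK (n + i)
    rw [show n + i + 1 = i + 1 + n by omega, Finset.sum_range_add, Finset.sum_range_succ,
      show n + i - i = n by omega, add_comm (∑ k ∈ Finset.range i, _)] at hsplit
    rw [show n + i + 1 = i + 1 + n by omega] at hle ⊢
    have := norm_sub_le (c n (v i) + ∑ k ∈ Finset.range i, c (n + i - k) (v k) +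
      ∑ k ∈ Finset.range n, c (n + i - (i + 1 + k)) (v (i + 1 + k)))
      (∑ k ∈ Finset.range n, c (n + i - (i + 1 + k)) (v (i + 1 + k)))
    rw [add_sub_cancel_right] at this
    linarith
  obtain ⟨i, hi⟩ := exists_nat_gt K
  have := lt_of_pow_lt_pow_left₀ (n + i + 1) (by positivity)
    ((key i).trans_lt (pow_lt_pow_left₀ (hi.trans (lt_add_one _)) hK0 (by omega)))
  exact lt_irrefl _ this

/-- Uniqueness of the coefficients of a power series in one complex variable. -/
theorem eq_of_eventually_hasSum_pow_smul {g : ℂ → F} {a b : ℕ → F}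
    (ha : ∀ᶠ z in 𝓝 (0 : ℂ), HasSum (fun n => z ^ n • a n) (g z))
    (hb : ∀ᶠ z in 𝓝 (0 : ℂ), HasSum (fun n => z ^ n • b n) (g z)) : a = b := by
  let series (a : ℕ → F) : FormalMultilinearSeries ℂ ℂ F :=
    fun n => ContinuousMultilinearMap.mkPiRing ℂ (Fin n) (a n)
  have coeff_series (a : ℕ → F) (n : ℕ) : (series a).coeff n = a n := by
    simp [series, FormalMultilinearSeries.coeff]
  have h : series a = series b :=
    HasFPowerSeriesAt.eq_formalMultilinearSeries (f := g) (x := 0)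
      (hasFPowerSeriesAt_iff.2 (by simpa [coeff_series] using ha))
      (hasFPowerSeriesAt_iff.2 (by simpa [coeff_series] using hb))
  funext n
  rw [← coeff_series a, h, coeff_series]

/-- The power series in `t` with coefficients in the unit ball is analytic at `0`. -/
theorem analyticAt_tsum_pow_smul [CompleteSpace E] {v : ℕ → E} (hv : ∀ i, ‖v i‖ ≤ 1) :
    AnalyticAt ℂ (fun t : ℂ => ∑' i, t ^ i • v i) 0 := by
  refine (Complex.differentiableOn_tsum_of_summable_norm (U := Metric.ball (0 : ℂ) 2⁻¹)
    (u := fun i : ℕ => (2⁻¹ : ℝ) ^ i) ?_ ?_ Metric.isOpen_ball ?_).analyticAt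
      (Metric.ball_mem_nhds _ (by norm_num))
  · exact summable_geometric_of_lt_one (by norm_num) (by norm_num)
  · intro i
    fun_prop
  · intro i t ht
    rw [mem_ball_zero_iff] at ht
    rw [norm_smul, norm_pow]
    calc ‖t‖ ^ i * ‖v i‖ ≤ 2⁻¹ ^ i * 1 := by gcongr; exact hv i
      _ = 2⁻¹ ^ i := mul_one _

theorem tsum_pow_smul_eq_add_smul [CompleteSpace E] {v : ℕ → E} (hv : ∀ i, ‖v i‖ ≤ 1)
    {t : ℂ} (ht : ‖t‖ < 1) :
    ∑' i, t ^ i • v i = v 0 + t • ∑' i, t ^ i • v (i + 1) := by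
  have hs (w : ℕ → E) (hw : ∀ i, ‖w i‖ ≤ 1) : Summable fun i => t ^ i • w i := by
    refine Summable.of_norm_bounded (summable_geometric_of_lt_one (norm_nonneg t) ht) fun i => ?_
    rw [norm_smul, norm_pow]
    exact mul_le_of_le_one_right (by positivity) (hw i)
  rw [(hs v hv).tsum_eq_zero_add, ← (hs _ fun i => hv (i + 1)).tsum_const_smul]
  simp [pow_succ', mul_smul]

/-- A family of bounded operators growing pointwise at most geometrically (relative to weights
`a n`) grows geometrically in norm. -/
theorem ContinuousLinearMap.exists_norm_le_of_pointwise_geometric [CompleteSpace E] {G : ℕ → Type*}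
    [∀ n, NormedAddCommGroup (G n)] [∀ n, NormedSpace ℂ (G n)] (T : ∀ n, E →L[ℂ] G n)
    (a : ℕ → ℝ) (ha : ∀ n, 0 ≤ a n)
    (hT : ∀ v, ∃ K : ℝ, 0 ≤ K ∧ ∀ n, ‖T n v‖ ≤ a n * K ^ (n + 1)) :
    ∃ C K : ℝ, 0 ≤ C ∧ 0 < K ∧ ∀ n, ‖T n‖ ≤ a n * (C * K ^ n) := by
  let A (k : ℕ) : Set E := ⋂ n, {v | ‖T n v‖ ≤ a n * (k : ℝ) ^ (n + 1)}
  have hA (k : ℕ) : IsClosed (A k) :=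
    isClosed_iInter fun n => isClosed_le (T n).continuous.norm continuous_const
  have hcover : ⋃ k, A k = Set.univ := by
    refine Set.eq_univ_of_forall fun v => ?_
    obtain ⟨K, hK0, hK⟩ := hT v
    obtain ⟨k, hk⟩ := exists_nat_ge K
    refine Set.mem_iUnion.2 ⟨k, Set.mem_iInter.2 fun n => (hK n).trans ?_⟩
    have := ha n
    gcongr
  obtain ⟨k, v₀, hv₀⟩ := nonempty_interior_of_iUnion_of_closed hA hcover
  obtain ⟨r, hr, hball⟩ := Metric.mem_nhds_iff.1 (mem_interior_iff_mem_nhds.1 hv₀)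
  have hmem {v : E} (hv : v ∈ Metric.ball v₀ r) (n : ℕ) : ‖T n v‖ ≤ a n * (k : ℝ) ^ (n + 1) :=
    Set.mem_iInter.1 (hball hv) n
  have hk : (k : ℝ) ≤ k + 1 := by linarith
  refine ⟨2 * (k + 1) / (r / 2), k + 1, by positivity, by positivity, fun n => ?_⟩
  have hbound (v : E) (hv : ‖v‖ < r) : ‖T n v‖ ≤ 2 * (a n * (k : ℝ) ^ (n + 1)) := by
    have h := norm_sub_le (T n (v₀ + v)) (T n v₀)
    rw [← map_sub, add_sub_cancel_left] at h
    have h₁ := hmem (v := v₀ + v) (by simpa using hv) n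
    have h₂ := hmem (Metric.mem_ball_self hr) n
    linarith
  have han := ha n
  refine ContinuousLinearMap.opNorm_le_of_shell (c := (2 : ℂ)) hr (by positivity) (by simp)
    fun v hv hvr => (hbound v hvr).trans ?_
  rw [Complex.norm_ofNat] at hv
  calc 2 * (a n * (k : ℝ) ^ (n + 1)) ≤ 2 * (a n * ((k : ℝ) + 1) ^ (n + 1)) * 1 := by
        rw [mul_one]; gcongr
    _ ≤ 2 * (a n * ((k : ℝ) + 1) ^ (n + 1)) * (‖v‖ / (r / 2)) := by
        gcongr
        rwa [one_le_div (by positivity)]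
    _ = _ := by rw [pow_succ]; ring

end Coefficients

section Taylor

variable {X F : Type*} [NormedAddCommGroup X] [NormedSpace ℂ X]
  [NormedAddCommGroup F] [NormedSpace ℂ F]

/-- A symmetric multilinear map is determined by its values on the diagonal. -/
theorem ContinuousMultilinearMap.eq_of_symmetric_of_diagonal {n : ℕ} {f g : X [×n]→L[ℂ] F}
    (hf : ∀ (σ : Equiv.Perm (Fin n)) x, f (fun i => x (σ i)) = f x)
    (hg : ∀ (σ : Equiv.Perm (Fin n)) x, g (fun i => x (σ i)) = g x)
    (h : ∀ x, f (fun _ => x) = g fun _ => x) : f = g := by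
  ext x
  have hfg : ∑ σ : Equiv.Perm (Fin n), f (fun i => x (σ i)) =
      ∑ σ : Equiv.Perm (Fin n), g (fun i => x (σ i)) := by
    rw [← f.iteratedFDeriv_comp_diagonal 0 x, ← g.iteratedFDeriv_comp_diagonal 0 x]
    simp only [h]
  simp only [hf, hg, Finset.sum_const, Finset.card_univ] at hfg
  rw [← Nat.cast_smul_eq_nsmul ℂ, ← Nat.cast_smul_eq_nsmul ℂ] at hfg
  exact smul_right_injective F (Nat.cast_ne_zero.2 Fintype.card_ne_zero) hfg

variable [CompleteSpace F]

/-- The Taylor series of a function that is analytic at `0` converges to it near `0`. -/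
theorem AnalyticAt.eventually_hasSum_iteratedFDeriv {f : X → F} (hf : AnalyticAt ℂ f 0) :
    ∀ᶠ x in 𝓝 (0 : X),
      HasSum (fun n => (n.factorial : ℂ)⁻¹ • iteratedFDeriv ℂ n f 0 fun _ => x) (f x) := by
  obtain ⟨p, r, hp⟩ := hf
  filter_upwards [Metric.eball_mem_nhds (0 : X) hp.r_pos] with x hx
  simpa using hp.hasSum_iteratedFDeriv hx

theorem AnalyticAt.eventually_hasSum_line {f : X → F} (hf : AnalyticAt ℂ f 0) (x : X) :
    ∀ᶠ z in 𝓝 (0 : ℂ), HasSum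
      (fun n => z ^ n • (n.factorial : ℂ)⁻¹ • iteratedFDeriv ℂ n f 0 fun _ => x) (f (z • x)) := by
  have hline : Tendsto (fun z : ℂ => z • x) (𝓝 0) (𝓝 0) :=
    (continuous_id.smul continuous_const).tendsto' _ _ (zero_smul ℂ x)
  filter_upwards [hline.eventually hf.eventually_hasSum_iteratedFDeriv] with z hz
  convert hz using 2 with n
  rw [(iteratedFDeriv ℂ n f 0).map_smul_univ (fun _ => z) (fun _ => x), smul_comm]
  simp

/-- Cauchy estimates for the derivatives at `0` of a function analytic at `0`. -/
theorem AnalyticAt.exists_norm_iteratedFDeriv_le {f : X → F} (hf : AnalyticAt ℂ f 0) :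
    ∃ K : ℝ, 0 ≤ K ∧ ∀ n, ‖iteratedFDeriv ℂ n f 0‖ ≤ n.factorial * K ^ (n + 1) := by
  obtain ⟨p, r, hp⟩ := hf
  obtain ⟨C, ρ, hC, hρ, hle⟩ :=
    p.le_mul_pow_of_radius_pos (hp.r_pos.trans_le hp.r_le)
  refine ⟨max C ρ, hC.le.trans (le_max_left _ _), fun n => ?_⟩
  refine ContinuousMultilinearMap.opNorm_le_bound (by positivity) fun x => ?_
  rw [hp.iteratedFDeriv_eq_sum_of_completeSpace]
  have hterm (σ : Equiv.Perm (Fin n)) :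
      ‖p n fun i => x (σ i)‖ ≤ max C ρ ^ (n + 1) * ∏ i, ‖x i‖ := by
    refine ((p n).le_opNorm _).trans ?_
    rw [Equiv.prod_comp σ fun i => ‖x i‖]
    gcongr
    refine (hle n).trans ?_
    rw [pow_succ']
    gcongr
    · exact le_max_left _ _
    · exact le_max_right _ _
  refine (norm_sum_le_of_le _ fun σ _ => hterm σ).trans ?_
  simp [Fintype.card_perm, mul_assoc]

end Taylor

section GermHom

variable {X E F : Type*} [NormedAddCommGroup X] [NormedSpace ℂ X]
  [NormedAddCommGroup E] [NormedSpace ℂ E] [NormedAddCommGroup F] [NormedSpace ℂ F]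

/-- A representative, analytic at `0`, of an element of `O^F_0`. -/
noncomputable def germRep (w : OEat X F 0) : X → F := w.2.choose

theorem analyticAt_germRep (w : OEat X F 0) : AnalyticAt ℂ (germRep w) 0 := w.2.choose_spec.1

theorem coe_germRep (w : OEat X F 0) : (w : Germ (𝓝 (0 : X)) F) = ↑(germRep w) := w.2.choose_spec.2

theorem germRep_add (w₁ w₂ : OEat X F 0) :
    germRep (w₁ + w₂) =ᶠ[𝓝 0] germRep w₁ + germRep w₂ := by
  rw [← Germ.coe_eq, ← coe_germRep, Germ.coe_add, ← coe_germRep, ← coe_germRep]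
  rfl

theorem germRep_smul {a : X → ℂ} (ha : AnalyticAt ℂ a 0) (w : OEat X F 0) :
    germRep ((⟨↑a, a, ha, rfl⟩ : Oat X 0) • w) =ᶠ[𝓝 0] fun x => a x • germRep w x := by
  rw [← Germ.coe_eq, ← coe_germRep]
  have : (((⟨↑a, a, ha, rfl⟩ : Oat X 0) • w : OEat X F 0) : Germ (𝓝 (0 : X)) F) =
    (↑a : Germ (𝓝 (0 : X)) ℂ) • (w : Germ (𝓝 (0 : X)) F) := rfl
  rw [this, coe_germRep]
  rfl

variable [CompleteSpace F]

/-- The `n`-th derivative at `0` of the images of the constant germs under a homomorphism. -/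
noncomputable def derivOnConst (φ : OEat X E 0 →ₗ[Oat X 0] OEat X F 0) (n : ℕ) :
    E →ₗ[ℂ] X [×n]→L[ℂ] F where
  toFun v := iteratedFDeriv ℂ n (germRep (φ (constGerm X E 0 v))) 0
  map_add' v w := by
    have h : constGerm X E 0 (v + w) = constGerm X E 0 v + constGerm X E 0 w := rfl
    rw [h, map_add, ((germRep_add _ _).iteratedFDeriv ℂ n).eq_of_nhds,
      iteratedFDeriv_add_apply (analyticAt_germRep _).contDiffAt
        (analyticAt_germRep _).contDiffAt]
  map_smul' c v := by
    have h : constGerm X E 0 (c • v) =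
      (⟨↑(fun _ : X => c), _, analyticAt_const, rfl⟩ : Oat X 0) • constGerm X E 0 v := rfl
    rw [h, map_smul, ((germRep_smul analyticAt_const _).iteratedFDeriv ℂ n).eq_of_nhds]
    exact iteratedFDeriv_const_smul_apply' (analyticAt_germRep _).contDiffAt

variable [CompleteSpace E]

/-- The germ at `0` of `∑ i, l ^ i • v i`, for a functional `l` and a sequence `v` in the unit
ball. -/
noncomputable def powerGerm (l : X →L[ℂ] ℂ) {v : ℕ → E} (hv : ∀ i, ‖v i‖ ≤ 1) : OEat X E 0 :=
  germOf X E 0 (fun x => ∑' i, l x ^ i • v i)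
    (AnalyticAt.comp_of_eq (analyticAt_tsum_pow_smul hv) (l.analyticAt 0) (map_zero l))

theorem powerGerm_eq (l : X →L[ℂ] ℂ) {v : ℕ → E} (hv : ∀ i, ‖v i‖ ≤ 1) :
    powerGerm l hv = constGerm X E 0 (v 0) +
      (⟨↑(l : X → ℂ), l, l.analyticAt 0, rfl⟩ : Oat X 0) •
        powerGerm l (v := fun i => v (i + 1)) (fun i => hv (i + 1)) := by
  have hl : ∀ᶠ x in 𝓝 (0 : X), ‖l x‖ < 1 := by
    have : Tendsto (fun x => ‖l x‖) (𝓝 0) (𝓝 0) := l.continuous.norm.tendsto' _ _ (by simp)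
    exact this.eventually_lt_const one_pos
  refine Subtype.ext (Germ.coe_eq.2 ?_)
  filter_upwards [hl] with x hx
  exact tsum_pow_smul_eq_add_smul hv hx

/-- The Taylor coefficients, on the line spanned by `x`, of the image of a power germ. -/
theorem taylor_powerGerm (φ : OEat X E 0 →ₗ[Oat X 0] OEat X F 0) {l : X →L[ℂ] ℂ} {x : X}
    (hlx : l x = 1) (j : ℕ) {v : ℕ → E} (hv : ∀ i, ‖v i‖ ≤ 1) :
    ((j.factorial : ℂ)⁻¹ • iteratedFDeriv ℂ j (germRep (φ (powerGerm l hv))) 0 fun _ => x) =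
      ∑ i ∈ Finset.range (j + 1),
        (((j - i).factorial : ℂ)⁻¹ • derivOnConst φ (j - i) (v i) fun _ => x) := by
  let coeff (w : OEat X F 0) (n : ℕ) : F :=
    (n.factorial : ℂ)⁻¹ • iteratedFDeriv ℂ n (germRep w) 0 fun _ => x
  have hcoeff (w : OEat X F 0) :
      ∀ᶠ z in 𝓝 (0 : ℂ), HasSum (fun n => z ^ n • coeff w n) (germRep w (z • x)) :=
    (analyticAt_germRep w).eventually_hasSum_line x
  have hline : Tendsto (fun z : ℂ => z • x) (𝓝 0) (𝓝 0) :=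
    (continuous_id.smul continuous_const).tendsto' _ _ (zero_smul ℂ x)
  have hrec {v : ℕ → E} (hv : ∀ i, ‖v i‖ ≤ 1) :
      coeff (φ (powerGerm l hv)) = fun n => coeff (φ (constGerm X E 0 (v 0))) n +
        Nat.casesOn n 0 (coeff (φ (powerGerm l (v := fun i => v (i + 1)) fun i => hv (i + 1)))) := by
    set w := powerGerm l (v := fun i => v (i + 1)) fun i => hv (i + 1)
    have heq : (germRep (φ (powerGerm l hv))) =ᶠ[𝓝 0]
        fun y => (germRep (φ (constGerm X E 0 (v 0)))) y + l y • germRep (φ w) y := by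
      rw [powerGerm_eq, map_add, map_smul]
      exact (germRep_add _ _).trans ((EventuallyEq.refl _ _).add (germRep_smul (l.analyticAt 0) _))
    refine eq_of_eventually_hasSum_pow_smul (hcoeff _) ?_
    filter_upwards [hline.eventually heq, hcoeff (φ (constGerm X E 0 (v 0))), hcoeff (φ w)]
      with z hz h₁ h₂
    rw [hz]
    simp only [smul_add]
    refine h₁.add ?_
    rw [← hasSum_nat_add_iff' 1]
    simpa [hlx, pow_succ', mul_smul] using h₂.const_smul z
  change coeff (φ (powerGerm l hv)) j =
    ∑ i ∈ Finset.range (j + 1), coeff (φ (constGerm X E 0 (v i))) (j - i)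
  induction j generalizing v with
  | zero => simpa using congrFun (hrec hv) 0
  | succ j ih =>
    rw [congrFun (hrec hv) (j + 1), Finset.sum_range_succ', add_comm]
    simp only [ih, Nat.add_sub_add_right, Nat.sub_zero]

/-- The derivatives of the images of constants are bounded on the unit ball, direction by
direction. -/
theorem derivOnConst_diagonal_bounded [Nontrivial X] (φ : OEat X E 0 →ₗ[Oat X 0] OEat X F 0)
    (n : ℕ) (x : X) : ∃ M : ℝ, ∀ v, ‖v‖ ≤ 1 → ‖derivOnConst φ n v fun _ => x‖ ≤ M := by
  wlog hx : x ≠ 0 generalizing x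
  · obtain rfl : x = 0 := not_not.1 hx
    cases n with
    | zero =>
      obtain ⟨y, hy⟩ := exists_ne (0 : X)
      obtain ⟨M, hM⟩ := this y hy
      refine ⟨M, fun v hv => ?_⟩
      rw [Subsingleton.elim (fun _ : Fin 0 => (0 : X)) fun _ => y]
      exact hM v hv
    | succ n =>
      exact ⟨0, fun v _ => by rw [(derivOnConst φ (n + 1) v).map_coord_zero 0 rfl, norm_zero]⟩
  obtain ⟨l, hlx⟩ : ∃ l : X →L[ℂ] ℂ, l x = 1 := by
    obtain ⟨l, hl⟩ := SeparatingDual.exists_eq_one (R := ℂ) hx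
    exact ⟨l, hl⟩
  let c (n : ℕ) : E →ₗ[ℂ] F :=
    (n.factorial : ℂ)⁻¹ • (ContinuousMultilinearMap.apply ℂ (fun _ : Fin n => X) F
      fun _ => x).toLinearMap ∘ₗ derivOnConst φ n
  have hc : ∃ M : ℝ, ∀ v, ‖v‖ ≤ 1 → ‖c n v‖ ≤ M := by
    refine LinearMap.bounded_of_convolution_growth c (fun v hv => ?_) n
    obtain ⟨K, hK0, hK⟩ :=
      (analyticAt_germRep (φ (powerGerm l hv))).exists_norm_iteratedFDeriv_le
    refine ⟨K * max 1 ‖x‖, by positivity, fun j => ?_⟩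
    have hfac : (0 : ℝ) < j.factorial := by exact_mod_cast j.factorial_pos
    have := taylor_powerGerm φ hlx j hv
    change _ = ∑ i ∈ Finset.range (j + 1), c (j - i) (v i) at this
    rw [← this, norm_smul, norm_inv, Complex.norm_natCast, inv_mul_le_iff₀ hfac]
    calc _ ≤ ‖iteratedFDeriv ℂ j (germRep (φ (powerGerm l hv))) 0‖ * ‖x‖ ^ j := by
          simpa using (iteratedFDeriv ℂ j (germRep (φ (powerGerm l hv))) 0).le_opNorm fun _ => x
      _ ≤ j.factorial * K ^ (j + 1) * max 1 ‖x‖ ^ (j + 1) := by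
          gcongr
          · exact hK j
          · exact (pow_le_pow_left₀ (norm_nonneg x) (le_max_right _ _) j).trans
              (pow_le_pow_right₀ (le_max_left _ _) j.le_succ)
      _ = _ := by rw [mul_pow, mul_assoc]
  obtain ⟨M, hM⟩ := hc
  refine ⟨n.factorial * M, fun v hv => ?_⟩
  have hfac : (0 : ℝ) < n.factorial := by exact_mod_cast n.factorial_pos
  have : ‖c n v‖ = (n.factorial : ℝ)⁻¹ * ‖derivOnConst φ n v fun _ => x‖ := by
    change ‖(n.factorial : ℂ)⁻¹ • (derivOnConst φ n v fun _ => x)‖ = _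
    rw [norm_smul, norm_inv, Complex.norm_natCast]
  rw [← inv_mul_le_iff₀ hfac, ← this]
  exact hM v hv

theorem continuous_derivOnConst [Nontrivial X] (φ : OEat X E 0 →ₗ[Oat X 0] OEat X F 0) (n : ℕ) :
    Continuous (derivOnConst φ n) := by
  have hdiag (x : X) : Continuous fun v => derivOnConst φ n v fun _ => x := by
    obtain ⟨M, hM⟩ := derivOnConst_diagonal_bounded φ n x
    let g : E →ₗ[ℂ] F := (ContinuousMultilinearMap.apply ℂ (fun _ : Fin n => X) F
      fun _ => x).toLinearMap ∘ₗ derivOnConst φ n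
    obtain ⟨C, hC⟩ := LinearMap.bound_of_ball_bound one_pos M g fun v hv =>
      hM v (mem_ball_zero_iff.1 hv).le
    exact AddMonoidHomClass.continuous_of_bound g C hC
  have hsymm (v : E) (σ : Equiv.Perm (Fin n)) (x : Fin n → X) :
      derivOnConst φ n v (fun i => x (σ i)) = derivOnConst φ n v x :=
    (analyticAt_germRep _).contDiffAt.iteratedFDeriv_comp_perm x σ
  refine LinearMap.continuous_of_seq_closed_graph _ fun u v y hu hy => ?_
  have happly (x : Fin n → X) :
      Tendsto (fun k => derivOnConst φ n (u k) x) atTop (𝓝 (y x)) :=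
    ((ContinuousMultilinearMap.apply ℂ (fun _ : Fin n => X) F x).continuous.tendsto y).comp hy
  refine ContinuousMultilinearMap.eq_of_symmetric_of_diagonal (fun σ x => ?_) (hsymm v) fun x => ?_
  · refine tendsto_nhds_unique (happly _) ?_
    simp only [hsymm]
    exact happly x
  · exact tendsto_nhds_unique (happly _) (((hdiag x).tendsto v).comp hu)

end GermHom

/-- Every `O_0`-homomorphism `O^E_0 → O^F_0` of germ modules at `0` in a
Banach space `X` with `dim X > 0` is, on constant germs, given by the action of a
`Hom(E,F)`-valued holomorphic germ. -/
theorem hom_eq_plain_on_const_germs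
    [CompleteSpace X] [Nontrivial X] [CompleteSpace E]
    (F : Type*) [NormedAddCommGroup F] [NormedSpace ℂ F] [CompleteSpace F]
    (φ : OEat X E 0 →ₗ[Oat X 0] OEat X F 0) :
    ∃ Φ : X → (E →L[ℂ] F), AnalyticAt ℂ Φ 0 ∧
      ∀ v : E, ((φ (constGerm X E 0 v) : OEat X F 0) : Filter.Germ (𝓝 (0 : X)) F) =
        ↑(fun x => Φ x v) := by
  let T (n : ℕ) : E →L[ℂ] X [×n]→L[ℂ] F := ⟨derivOnConst φ n, continuous_derivOnConst φ n⟩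
  obtain ⟨C, K, hC, hK, hT⟩ := ContinuousLinearMap.exists_norm_le_of_pointwise_geometric T
    (fun n => (n.factorial : ℝ)) (fun n => by positivity)
    (fun v => (analyticAt_germRep _).exists_norm_iteratedFDeriv_le)
  let P : FormalMultilinearSeries ℂ X (E →L[ℂ] F) :=
    fun n => ((n.factorial : ℂ)⁻¹ • T n).flipMultilinear
  have hP (n : ℕ) : ‖P n‖ ≤ C * K ^ n := by
    have hfac : (0 : ℝ) < n.factorial := by exact_mod_cast n.factorial_pos
    refine (MultilinearMap.mkContinuous_norm_le _ (norm_nonneg _) _).trans ?_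
    rw [norm_smul, norm_inv, Complex.norm_natCast, inv_mul_le_iff₀ hfac]
    exact hT n
  have hradius : 0 < P.radius := by
    refine lt_of_lt_of_le ?_ (P.le_radius_of_bound C (r := Real.toNNReal K⁻¹) fun n => ?_)
    · simpa using hK
    · rw [Real.coe_toNNReal _ (by positivity), inv_pow, ← div_eq_mul_inv,
        div_le_iff₀ (by positivity)]
      exact hP n
  have hΦ := P.hasFPowerSeriesOnBall hradius
  refine ⟨P.sum, hΦ.analyticAt, fun v => ?_⟩
  rw [coe_germRep, Germ.coe_eq]
  filter_upwards [(analyticAt_germRep (φ (constGerm X E 0 v))).eventually_hasSum_iteratedFDeriv,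
    Metric.eball_mem_nhds (0 : X) hradius] with x hx hxr
  have hsum := (ContinuousLinearMap.apply ℂ F v).hasSum (hΦ.hasSum hxr)
  rw [zero_add] at hsum
  exact hx.unique hsum
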